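/- Let A ∈ ℝ^{s×s} be strictly lower triangular, b_1,…,b_r ∈ ℝ^s, w ∈ ℝ^s, and let p ≥ 2 be such that b_k^T A^j w = 0 for all k and all 0 ≤ j ≤ p−3. Let L ∈ ℝ^{m×m}, Δt > 0, Z = Δt L with ‖Z‖_∞ ≤ M, and take the cell-based splitting Z_k = I_k Z, where I_1,…,I_r are diagonal matrices with entries in {0,1} and I_1 + ⋯ + I_r = I. Define Q(Z) = Σ_{k=1}^{r} Σ_{j=0}^{s-1} (b_k^T A^j w) Z_k Z^j. Then there is a constant C depending only on s, r, p, M and the numbers |b_k^T A^j w| such that for every v ∈ ℝ^m: ‖Q(Z) v‖_∞ ≤ C Δt^{p-1} ‖L^{p-1} v‖_∞. -/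

import Mathlib

open Matrix

attribute [local instance] Matrix.linftyOpNormedAddCommGroup

/-- A diagonal 0/1 matrix does not increase the maximum norm. -/
lemma norm_mulVec_le_of_diagonal_zero_one {m : ℕ} (P : Matrix (Fin m) (Fin m) ℝ)
    (hoff : ∀ a a' : Fin m, a ≠ a' → P a a' = 0)
    (hdiag : ∀ a : Fin m, P a a = 0 ∨ P a a = 1) (x : Fin m → ℝ) :
    ‖P.mulVec x‖ ≤ ‖x‖ := by
  refine (pi_norm_le_iff_of_nonneg (norm_nonneg x)).2 fun a => ?_
  have h : P.mulVec x a = P a a * x a := by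
    change ∑ c, P a c * x c = _
    exact Finset.sum_eq_single a (fun c _ hc => by rw [hoff a c hc.symm, zero_mul]) (by simp)
  rw [h]
  rcases hdiag a with h0 | h1
  · simp [h0]
  · simpa [h1] using norm_le_pi_norm x a

lemma norm_pow_mulVec_le {m : ℕ} (Z : Matrix (Fin m) (Fin m) ℝ) {M : ℝ} (hZ : ‖Z‖ ≤ M)
    (n : ℕ) (x : Fin m → ℝ) : ‖(Z ^ n).mulVec x‖ ≤ M ^ n * ‖x‖ := by
  have hM : 0 ≤ M := (norm_nonneg Z).trans hZ
  induction n with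
  | zero => simp
  | succ n ih =>
    rw [pow_succ' Z, ← mulVec_mulVec]
    calc ‖Z.mulVec ((Z ^ n).mulVec x)‖ ≤ ‖Z‖ * ‖(Z ^ n).mulVec x‖ :=
          linfty_opNorm_mulVec _ _
      _ ≤ M * (M ^ n * ‖x‖) := by gcongr
      _ = M ^ (n + 1) * ‖x‖ := by ring

/-- Cell-based splitting bound: if `bₖᵀ Aʲ w = 0` for `0 ≤ j ≤ p−3`, `‖Z‖_∞ ≤ M` with
`Z = Δt L`, and `Zₖ = Iₖ Z` with diagonal 0/1 projections `Iₖ` summing to `I`, then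
`‖Q(Z) v‖_∞ ≤ C Δt^{p−1} ‖L^{p−1} v‖_∞` where
`Q(Z) = ∑ₖ ∑_{j<s} (bₖᵀ Aʲ w) Zₖ Zʲ`, with `C` depending only on `s, r, p, M` and the
numbers `|bₖᵀ Aʲ w|`. -/
theorem stmt_17
    (s r p : ℕ) (hp : 2 ≤ p)
    (A : Matrix (Fin s) (Fin s) ℝ)
    (hA : ∀ i j : Fin s, i ≤ j → A i j = 0)
    (b : Fin r → Fin s → ℝ)
    (w : Fin s → ℝ)
    (hord : ∀ (k : Fin r) (j : ℕ), j + 3 ≤ p → ∑ i, b k i * ((A ^ j).mulVec w) i = 0)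
    (M : ℝ) :
    ∃ C > 0,
      ∀ (m : ℕ) (L : Matrix (Fin m) (Fin m) ℝ) (Δt : ℝ), 0 < Δt →
        ‖Δt • L‖ ≤ M →
        ∀ (Iproj : Fin r → Matrix (Fin m) (Fin m) ℝ),
          (∀ (k : Fin r) (a a' : Fin m), a ≠ a' → Iproj k a a' = 0) →
          (∀ (k : Fin r) (a : Fin m), Iproj k a a = 0 ∨ Iproj k a a = 1) →
          (∑ k, Iproj k) = 1 →
          ∀ v : Fin m → ℝ,
            ‖(∑ k, ∑ j ∈ Finset.range s,
                (∑ i, b k i * ((A ^ j).mulVec w) i) •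
                  ((Iproj k * (Δt • L)) * (Δt • L) ^ j)).mulVec v‖
              ≤ C * Δt ^ (p - 1) * ‖(L ^ (p - 1)).mulVec v‖ := by
  set q : Fin r → ℕ → ℝ := fun k j => ∑ i, b k i * ((A ^ j).mulVec w) i with hq
  refine ⟨1 + ∑ k, ∑ j ∈ Finset.range s, |q k j| * |M| ^ (j + 2 - p), by positivity, ?_⟩
  intro m L Δt hΔt hZ P hoff hdiag _ v
  have hZ' : ‖Δt • L‖ ≤ |M| := hZ.trans (le_abs_self M)
  have hterm : ∀ k j, ‖(q k j • ((P k * (Δt • L)) * (Δt • L) ^ j)).mulVec v‖ ≤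
      |q k j| * |M| ^ (j + 2 - p) * (Δt ^ (p - 1) * ‖(L ^ (p - 1)).mulVec v‖) := by
    intro k j
    by_cases hj : j + 3 ≤ p
    · have h0 : q k j = 0 := hord k j hj
      simp [h0]
    · have hexp : j + 1 = (j + 2 - p) + (p - 1) := by omega
      have hpow : ‖((Δt • L) ^ (p - 1)).mulVec v‖ =
          Δt ^ (p - 1) * ‖(L ^ (p - 1)).mulVec v‖ := by
        rw [smul_pow, smul_mulVec, norm_smul, norm_pow, Real.norm_of_nonneg hΔt.le]
      rw [smul_mulVec, norm_smul, Real.norm_eq_abs, mul_assoc (P k), ← pow_succ', hexp,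
        pow_add, ← mulVec_mulVec, ← mulVec_mulVec, mul_assoc, ← hpow]
      gcongr
      exact (norm_mulVec_le_of_diagonal_zero_one (P k) (hoff k) (hdiag k) _).trans
        (norm_pow_mulVec_le _ hZ' _ _)
  have hnn : 0 ≤ Δt ^ (p - 1) * ‖(L ^ (p - 1)).mulVec v‖ := by positivity
  simp only [sum_mulVec]
  calc _ ≤ ∑ k, ∑ j ∈ Finset.range s,
        |q k j| * |M| ^ (j + 2 - p) * (Δt ^ (p - 1) * ‖(L ^ (p - 1)).mulVec v‖) :=
        norm_sum_le_of_le _ fun k _ => norm_sum_le_of_le _ fun j _ => hterm k j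
    _ = (∑ k, ∑ j ∈ Finset.range s, |q k j| * |M| ^ (j + 2 - p)) *
        (Δt ^ (p - 1) * ‖(L ^ (p - 1)).mulVec v‖) := by simp only [Finset.sum_mul]
    _ ≤ _ := by
      rw [mul_assoc]
      gcongr
      linarith
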